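/- For any family B of 011-PI kernels of size (n0,n1)×(p0,p1) and any family D of 011-PI kernels of size (p0,p1)×(m0,m1), there exists a family R of 011-PI kernels of size (n0,n1)×(m0,m1) such that for every triple (v, u1, u2) with v ∈ ℝ^{m0} and continuous u1 : [a,b] → ℝ^{m1}, u2 : [c,d] → ℝ^{m1}, the composition satisfies P[B](P[D](v,u1,u2)) = P[R](v,u1,u2). In other words, the 011-PI operators are closed under composition. -/

import Mathlib

open Matrix MeasureTheory Set

noncomputable section

/-- A family of 1D-PI kernels of size `p × r` (the parameters of a 1D-PI operator). -/
structure PI1DK (p r : ℕ) where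
  k0 : ℝ → Matrix (Fin p) (Fin r) ℝ
  k1 : ℝ → ℝ → Matrix (Fin p) (Fin r) ℝ
  k2 : ℝ → ℝ → Matrix (Fin p) (Fin r) ℝ

/-- Continuity of a family of 1D-PI kernels on the interval `[s,t]`. -/
def PI1DK.IsCont {p r : ℕ} (s t : ℝ) (N : PI1DK p r) : Prop :=
  ContinuousOn N.k0 (Icc s t) ∧
  ContinuousOn (fun q : ℝ × ℝ => N.k1 q.1 q.2) (Icc s t ×ˢ Icc s t) ∧
  ContinuousOn (fun q : ℝ × ℝ => N.k2 q.1 q.2) (Icc s t ×ˢ Icc s t)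

/-- The 1D-PI operator on `[s,t]` associated with the kernels `N`. -/
def PI1D {p r : ℕ} (s t : ℝ) (N : PI1DK p r) (u : ℝ → Fin r → ℝ) (x : ℝ) :
    Fin p → ℝ :=
  N.k0 x *ᵥ u x + (∫ θ in s..x, N.k1 x θ *ᵥ u θ) + (∫ θ in x..t, N.k2 x θ *ᵥ u θ)

/-- Entrywise interval integral of a matrix-valued function. -/
def mInt {p r : ℕ} (s t : ℝ) (F : ℝ → Matrix (Fin p) (Fin r) ℝ) :
    Matrix (Fin p) (Fin r) ℝ :=
  Matrix.of fun i j => ∫ η in s..t, F η i j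

/-- A family of 2D-PI kernels of size `p × r`. -/
structure PI2DK (p r : ℕ) where
  k00 : ℝ → ℝ → Matrix (Fin p) (Fin r) ℝ
  k10 : ℝ → ℝ → ℝ → Matrix (Fin p) (Fin r) ℝ
  k20 : ℝ → ℝ → ℝ → Matrix (Fin p) (Fin r) ℝ
  k01 : ℝ → ℝ → ℝ → Matrix (Fin p) (Fin r) ℝ
  k02 : ℝ → ℝ → ℝ → Matrix (Fin p) (Fin r) ℝ
  k11 : ℝ → ℝ → ℝ → ℝ → Matrix (Fin p) (Fin r) ℝ
  k21 : ℝ → ℝ → ℝ → ℝ → Matrix (Fin p) (Fin r) ℝ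
  k12 : ℝ → ℝ → ℝ → ℝ → Matrix (Fin p) (Fin r) ℝ
  k22 : ℝ → ℝ → ℝ → ℝ → Matrix (Fin p) (Fin r) ℝ

/-- Continuity of a family of 2D-PI kernels on `[a,b] × [c,d]`. -/
def PI2DK.IsCont {p r : ℕ} (a b c d : ℝ) (N : PI2DK p r) : Prop :=
  ContinuousOn (fun q : ℝ × ℝ => N.k00 q.1 q.2) (Icc a b ×ˢ Icc c d) ∧
  ContinuousOn (fun q : ℝ × ℝ × ℝ => N.k10 q.1 q.2.1 q.2.2)
    (Icc a b ×ˢ Icc c d ×ˢ Icc a b) ∧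
  ContinuousOn (fun q : ℝ × ℝ × ℝ => N.k20 q.1 q.2.1 q.2.2)
    (Icc a b ×ˢ Icc c d ×ˢ Icc a b) ∧
  ContinuousOn (fun q : ℝ × ℝ × ℝ => N.k01 q.1 q.2.1 q.2.2)
    (Icc a b ×ˢ Icc c d ×ˢ Icc c d) ∧
  ContinuousOn (fun q : ℝ × ℝ × ℝ => N.k02 q.1 q.2.1 q.2.2)
    (Icc a b ×ˢ Icc c d ×ˢ Icc c d) ∧
  ContinuousOn (fun q : ℝ × ℝ × ℝ × ℝ => N.k11 q.1 q.2.1 q.2.2.1 q.2.2.2)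
    (Icc a b ×ˢ Icc c d ×ˢ Icc a b ×ˢ Icc c d) ∧
  ContinuousOn (fun q : ℝ × ℝ × ℝ × ℝ => N.k21 q.1 q.2.1 q.2.2.1 q.2.2.2)
    (Icc a b ×ˢ Icc c d ×ˢ Icc a b ×ˢ Icc c d) ∧
  ContinuousOn (fun q : ℝ × ℝ × ℝ × ℝ => N.k12 q.1 q.2.1 q.2.2.1 q.2.2.2)
    (Icc a b ×ˢ Icc c d ×ˢ Icc a b ×ˢ Icc c d) ∧
  ContinuousOn (fun q : ℝ × ℝ × ℝ × ℝ => N.k22 q.1 q.2.1 q.2.2.1 q.2.2.2)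
    (Icc a b ×ˢ Icc c d ×ˢ Icc a b ×ˢ Icc c d)

/-- The 2D-PI operator on `[a,b] × [c,d]` associated with the kernels `N`. -/
def PI2D {p r : ℕ} (a b c d : ℝ) (N : PI2DK p r) (u : ℝ → ℝ → Fin r → ℝ)
    (x y : ℝ) : Fin p → ℝ :=
  N.k00 x y *ᵥ u x y
  + (∫ θ in a..x, N.k10 x y θ *ᵥ u θ y)
  + (∫ θ in x..b, N.k20 x y θ *ᵥ u θ y)
  + (∫ ν in c..y, N.k01 x y ν *ᵥ u x ν)
  + (∫ ν in y..d, N.k02 x y ν *ᵥ u x ν)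
  + (∫ θ in a..x, ∫ ν in c..y, N.k11 x y θ ν *ᵥ u θ ν)
  + (∫ θ in x..b, ∫ ν in c..y, N.k21 x y θ ν *ᵥ u θ ν)
  + (∫ θ in a..x, ∫ ν in y..d, N.k12 x y θ ν *ᵥ u θ ν)
  + (∫ θ in x..b, ∫ ν in y..d, N.k22 x y θ ν *ᵥ u θ ν)

/-- A family of 011-PI kernels of size `(p0,p1) × (r0,r1)`. -/
structure PI011K (p0 p1 r0 r1 : ℕ) where
  b00 : Matrix (Fin p0) (Fin r0) ℝ
  b01 : ℝ → Matrix (Fin p0) (Fin r1) ℝ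
  b02 : ℝ → Matrix (Fin p0) (Fin r1) ℝ
  b10 : ℝ → Matrix (Fin p1) (Fin r0) ℝ
  b20 : ℝ → Matrix (Fin p1) (Fin r0) ℝ
  b12 : ℝ → ℝ → Matrix (Fin p1) (Fin r1) ℝ
  b21 : ℝ → ℝ → Matrix (Fin p1) (Fin r1) ℝ
  b11 : PI1DK p1 r1
  b22 : PI1DK p1 r1

/-- Continuity of a family of 011-PI kernels. -/
def PI011K.IsCont {p0 p1 r0 r1 : ℕ} (a b c d : ℝ) (B : PI011K p0 p1 r0 r1) : Prop :=
  ContinuousOn B.b01 (Icc a b) ∧ ContinuousOn B.b02 (Icc c d) ∧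
  ContinuousOn B.b10 (Icc a b) ∧ ContinuousOn B.b20 (Icc c d) ∧
  ContinuousOn (fun q : ℝ × ℝ => B.b12 q.1 q.2) (Icc a b ×ˢ Icc c d) ∧
  ContinuousOn (fun q : ℝ × ℝ => B.b21 q.1 q.2) (Icc c d ×ˢ Icc a b) ∧
  B.b11.IsCont a b ∧ B.b22.IsCont c d

/-- The 011-PI operator associated with the kernels `B`. -/
def PI011 {p0 p1 r0 r1 : ℕ} (a b c d : ℝ) (B : PI011K p0 p1 r0 r1)
    (v : Fin r0 → ℝ) (u1 u2 : ℝ → Fin r1 → ℝ) :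
    (Fin p0 → ℝ) × (ℝ → Fin p1 → ℝ) × (ℝ → Fin p1 → ℝ) :=
  ( B.b00 *ᵥ v + (∫ θ in a..b, B.b01 θ *ᵥ u1 θ) + (∫ ν in c..d, B.b02 ν *ᵥ u2 ν),
    fun x => B.b10 x *ᵥ v + PI1D a b B.b11 u1 x + (∫ ν in c..d, B.b12 x ν *ᵥ u2 ν),
    fun y => B.b20 y *ᵥ v + (∫ θ in a..b, B.b21 y θ *ᵥ u1 θ) + PI1D c d B.b22 u2 y )

/-- A family of (2D→011)-PI kernels of size `(p0,p1) × r`. -/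
structure PI2Dto011K (p0 p1 r : ℕ) where
  d0 : ℝ → ℝ → Matrix (Fin p0) (Fin r) ℝ
  d10 : ℝ → ℝ → Matrix (Fin p1) (Fin r) ℝ
  d11 : ℝ → ℝ → ℝ → Matrix (Fin p1) (Fin r) ℝ
  d12 : ℝ → ℝ → ℝ → Matrix (Fin p1) (Fin r) ℝ
  d20 : ℝ → ℝ → Matrix (Fin p1) (Fin r) ℝ
  d21 : ℝ → ℝ → ℝ → Matrix (Fin p1) (Fin r) ℝ
  d22 : ℝ → ℝ → ℝ → Matrix (Fin p1) (Fin r) ℝ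

/-- Continuity of a family of (2D→011)-PI kernels. -/
def PI2Dto011K.IsCont {p0 p1 r : ℕ} (a b c d : ℝ) (D : PI2Dto011K p0 p1 r) : Prop :=
  ContinuousOn (fun q : ℝ × ℝ => D.d0 q.1 q.2) (Icc a b ×ˢ Icc c d) ∧
  ContinuousOn (fun q : ℝ × ℝ => D.d10 q.1 q.2) (Icc a b ×ˢ Icc c d) ∧
  ContinuousOn (fun q : ℝ × ℝ × ℝ => D.d11 q.1 q.2.1 q.2.2)
    (Icc a b ×ˢ Icc c d ×ˢ Icc a b) ∧
  ContinuousOn (fun q : ℝ × ℝ × ℝ => D.d12 q.1 q.2.1 q.2.2)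
    (Icc a b ×ˢ Icc c d ×ˢ Icc a b) ∧
  ContinuousOn (fun q : ℝ × ℝ => D.d20 q.1 q.2) (Icc a b ×ˢ Icc c d) ∧
  ContinuousOn (fun q : ℝ × ℝ × ℝ => D.d21 q.1 q.2.1 q.2.2)
    (Icc a b ×ˢ Icc c d ×ˢ Icc c d) ∧
  ContinuousOn (fun q : ℝ × ℝ × ℝ => D.d22 q.1 q.2.1 q.2.2)
    (Icc a b ×ˢ Icc c d ×ˢ Icc c d)

/-- The (2D→011)-PI operator associated with the kernels `D`. -/
def PI2Dto011 {p0 p1 r : ℕ} (a b c d : ℝ) (D : PI2Dto011K p0 p1 r)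
    (u : ℝ → ℝ → Fin r → ℝ) :
    (Fin p0 → ℝ) × (ℝ → Fin p1 → ℝ) × (ℝ → Fin p1 → ℝ) :=
  ( ∫ θ in a..b, ∫ ν in c..d, D.d0 θ ν *ᵥ u θ ν,
    fun x => ∫ y in c..d,
      (D.d10 x y *ᵥ u x y + (∫ θ in a..x, D.d11 x y θ *ᵥ u θ y)
        + (∫ θ in x..b, D.d12 x y θ *ᵥ u θ y)),
    fun y => ∫ x in a..b,
      (D.d20 x y *ᵥ u x y + (∫ ν in c..y, D.d21 x y ν *ᵥ u x ν)
        + (∫ ν in y..d, D.d22 x y ν *ᵥ u x ν)) )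

/-- A family of (011→2D)-PI kernels of size `p × (r0,r1)`. -/
structure PI011to2DK (p r0 r1 : ℕ) where
  e0 : ℝ → ℝ → Matrix (Fin p) (Fin r0) ℝ
  e10 : ℝ → ℝ → Matrix (Fin p) (Fin r1) ℝ
  e11 : ℝ → ℝ → ℝ → Matrix (Fin p) (Fin r1) ℝ
  e12 : ℝ → ℝ → ℝ → Matrix (Fin p) (Fin r1) ℝ
  e20 : ℝ → ℝ → Matrix (Fin p) (Fin r1) ℝ
  e21 : ℝ → ℝ → ℝ → Matrix (Fin p) (Fin r1) ℝ
  e22 : ℝ → ℝ → ℝ → Matrix (Fin p) (Fin r1) ℝ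

/-- Continuity of a family of (011→2D)-PI kernels. -/
def PI011to2DK.IsCont {p r0 r1 : ℕ} (a b c d : ℝ) (E : PI011to2DK p r0 r1) : Prop :=
  ContinuousOn (fun q : ℝ × ℝ => E.e0 q.1 q.2) (Icc a b ×ˢ Icc c d) ∧
  ContinuousOn (fun q : ℝ × ℝ => E.e10 q.1 q.2) (Icc a b ×ˢ Icc c d) ∧
  ContinuousOn (fun q : ℝ × ℝ × ℝ => E.e11 q.1 q.2.1 q.2.2)
    (Icc a b ×ˢ Icc c d ×ˢ Icc a b) ∧
  ContinuousOn (fun q : ℝ × ℝ × ℝ => E.e12 q.1 q.2.1 q.2.2)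
    (Icc a b ×ˢ Icc c d ×ˢ Icc a b) ∧
  ContinuousOn (fun q : ℝ × ℝ => E.e20 q.1 q.2) (Icc a b ×ˢ Icc c d) ∧
  ContinuousOn (fun q : ℝ × ℝ × ℝ => E.e21 q.1 q.2.1 q.2.2)
    (Icc a b ×ˢ Icc c d ×ˢ Icc c d) ∧
  ContinuousOn (fun q : ℝ × ℝ × ℝ => E.e22 q.1 q.2.1 q.2.2)
    (Icc a b ×ˢ Icc c d ×ˢ Icc c d)

/-- The (011→2D)-PI operator associated with the kernels `E`. -/
def PI011to2D {p r0 r1 : ℕ} (a b c d : ℝ) (E : PI011to2DK p r0 r1)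
    (v : Fin r0 → ℝ) (u1 u2 : ℝ → Fin r1 → ℝ) (x y : ℝ) : Fin p → ℝ :=
  E.e0 x y *ᵥ v + E.e10 x y *ᵥ u1 x
  + (∫ θ in a..x, E.e11 x y θ *ᵥ u1 θ) + (∫ θ in x..b, E.e12 x y θ *ᵥ u1 θ)
  + E.e20 x y *ᵥ u2 y
  + (∫ ν in c..y, E.e21 x y ν *ᵥ u2 ν) + (∫ ν in y..d, E.e22 x y ν *ᵥ u2 ν)

/-! ### Iterated interval integrals of continuous functions -/

section Fubini

variable {E : Type*} [NormedAddCommGroup E] [NormedSpace ℝ E]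

@[fun_prop]
theorem continuous_intervalIntegral {X : Type*} [TopologicalSpace X] {G : X → ℝ → E}
    (hG : Continuous fun q : X × ℝ => G q.1 q.2) {l r : X → ℝ} (hl : Continuous l)
    (hr : Continuous r) : Continuous fun x => ∫ θ in l x..r x, G x θ := by
  have : (fun x => ∫ θ in l x..r x, G x θ) =
      fun x => (∫ θ in (0 : ℝ)..r x, G x θ) - ∫ θ in (0 : ℝ)..l x, G x θ := by
    ext x
    have hc : Continuous fun θ => G x θ := by fun_prop
    exact (intervalIntegral.integral_interval_sub_left (hc.intervalIntegrable _ _)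
      (hc.intervalIntegrable _ _)).symm
  rw [this]
  fun_prop

theorem intervalIntegral_swap_of_continuous {G : ℝ → ℝ → E}
    (hG : Continuous fun q : ℝ × ℝ => G q.1 q.2)
    (s t p q : ℝ) :
    ∫ η in s..t, ∫ θ in p..q, G η θ = ∫ θ in p..q, ∫ η in s..t, G η θ := by
  refine MeasureTheory.intervalIntegral_intervalIntegral_swap ?_
  exact (hG.continuousOn.integrableOn_compact (isCompact_uIcc.prod isCompact_uIcc)).mono_set
    (prod_mono uIoc_subset_uIcc uIoc_subset_uIcc)

theorem intervalIntegral_triangle_swap_of_le {G : ℝ → ℝ → E}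
    (hG : Continuous fun q : ℝ × ℝ => G q.1 q.2) {s x : ℝ} (h : s ≤ x) :
    ∫ η in s..x, ∫ θ in s..η, G η θ = ∫ θ in s..x, ∫ η in θ..x, G η θ := by
  let F : ℝ → ℝ → E := fun η => indicator {θ | θ ≤ η} (G η)
  have hF : IntegrableOn (Function.uncurry F) (uIoc s x ×ˢ uIoc s x) := by
    have : Function.uncurry F = indicator {q : ℝ × ℝ | q.2 ≤ q.1} fun q => G q.1 q.2 := by
      ext q
      simp [F, Function.uncurry, indicator]
    rw [this]
    refine IntegrableOn.indicator ?_ (measurableSet_le measurable_snd measurable_fst)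
    exact (hG.continuousOn.integrableOn_compact (isCompact_uIcc.prod isCompact_uIcc)).mono_set
      (prod_mono uIoc_subset_uIcc uIoc_subset_uIcc)
  have hl : ∀ η ∈ uIcc s x, ∫ θ in s..x, F η θ = ∫ θ in s..η, G η θ := fun η hη =>
    intervalIntegral.integral_indicator (by rwa [uIcc_of_le h] at hη)
  have hr : ∀ θ ∈ uIcc s x, ∫ η in s..x, F η θ = ∫ η in θ..x, G η θ := by
    intro θ hθ
    rw [uIcc_of_le h] at hθ
    have hc : Continuous fun η => G η θ := hG.comp (by fun_prop : Continuous fun η : ℝ => (η, θ))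
    have hFe : (fun η => F η θ) = indicator (Ici θ) fun η => G η θ := by
      ext η
      simp [F, indicator]
    rw [hFe, intervalIntegral.integral_of_le h, intervalIntegral.integral_of_le hθ.2,
      setIntegral_indicator measurableSet_Ici]
    refine setIntegral_congr_set ?_
    have : (Ioc s x ∩ Ioi θ : Set ℝ) = Ioc θ x := by
      rw [Ioc_inter_Ioi, sup_eq_right.2 hθ.1]
    rw [← this]
    exact (ae_eq_refl _).inter Ioi_ae_eq_Ici.symm
  rw [← intervalIntegral.integral_congr hl, ← intervalIntegral.integral_congr hr]
  refine MeasureTheory.intervalIntegral_intervalIntegral_swap ?_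
  exact hF

/-- Fubini's theorem on a triangle. -/
theorem intervalIntegral_triangle_swap {G : ℝ → ℝ → E}
    (hG : Continuous fun q : ℝ × ℝ => G q.1 q.2) (s x : ℝ) :
    ∫ η in s..x, ∫ θ in s..η, G η θ = ∫ θ in s..x, ∫ η in θ..x, G η θ := by
  rcases le_total s x with h | h
  · exact intervalIntegral_triangle_swap_of_le hG h
  · have := intervalIntegral_triangle_swap_of_le (G := fun η θ => G θ η)
      (hG.comp continuous_swap) h
    rw [intervalIntegral.integral_symm x s, intervalIntegral.integral_symm x s, neg_inj]
    have h₁ : ∀ η, ∫ θ in s..η, G η θ = -∫ θ in η..s, G η θ := fun η =>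
      intervalIntegral.integral_symm _ _
    have h₂ : ∀ θ, ∫ η in θ..x, G η θ = -∫ η in x..θ, G η θ := fun θ =>
      intervalIntegral.integral_symm _ _
    simp only [h₁, h₂, intervalIntegral.integral_neg, this]

theorem intervalIntegral_triangle_swap' {G : ℝ → ℝ → E}
    (hG : Continuous fun q : ℝ × ℝ => G q.1 q.2) (x t : ℝ) :
    ∫ η in x..t, ∫ θ in η..t, G η θ = ∫ θ in x..t, ∫ η in x..θ, G η θ :=
  (intervalIntegral_triangle_swap (G := fun η θ => G θ η) (hG.comp continuous_swap) x t).symm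

/-- The change of order of integration behind the composition of two 1D-PI operators. -/
theorem intervalIntegral_PI_swap {G₁₁ G₁₂ G₂₁ G₂₂ : ℝ → ℝ → E}
    (h₁₁ : Continuous fun q : ℝ × ℝ => G₁₁ q.1 q.2) (h₁₂ : Continuous fun q : ℝ × ℝ => G₁₂ q.1 q.2)
    (h₂₁ : Continuous fun q : ℝ × ℝ => G₂₁ q.1 q.2) (h₂₂ : Continuous fun q : ℝ × ℝ => G₂₂ q.1 q.2)
    (s x t : ℝ) :
    (∫ η in s..x, ((∫ θ in s..η, G₁₁ η θ) + ∫ θ in η..t, G₁₂ η θ)) +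
        (∫ η in x..t, ((∫ θ in s..η, G₂₁ η θ) + ∫ θ in η..t, G₂₂ η θ)) =
      (∫ θ in s..x, ((∫ η in s..θ, G₁₂ η θ) + (∫ η in θ..x, G₁₁ η θ) + ∫ η in x..t, G₂₁ η θ)) +
        ∫ θ in x..t, ((∫ η in s..x, G₁₂ η θ) + (∫ η in x..θ, G₂₂ η θ) +
          ∫ η in θ..t, G₂₁ η θ) := by
  have split : ∀ {g : ℝ → E}, Continuous g → ∀ p m q : ℝ,
      ∫ θ in p..q, g θ = (∫ θ in p..m, g θ) + ∫ θ in m..q, g θ := fun hg p m q =>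
    (intervalIntegral.integral_add_adjacent_intervals (hg.intervalIntegrable _ _)
      (hg.intervalIntegrable _ _)).symm
  have hc : ∀ {G : ℝ → ℝ → E}, (Continuous fun q : ℝ × ℝ => G q.1 q.2) →
      ∀ η, Continuous fun θ => G η θ := fun hG η => by fun_prop
  have hi : ∀ {G : ℝ → ℝ → E}, (Continuous fun q : ℝ × ℝ => G q.1 q.2) →
      ∀ {l r : ℝ → ℝ}, Continuous l → Continuous r → ∀ p q : ℝ,
        IntervalIntegrable (fun η => ∫ θ in l η..r η, G η θ) volume p q :=
    fun hG _ _ hl hr p q => (continuous_intervalIntegral hG hl hr).intervalIntegrable p q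
  have hs : ∀ {G : ℝ → ℝ → E}, (Continuous fun q : ℝ × ℝ => G q.1 q.2) →
      Continuous fun q : ℝ × ℝ => G q.2 q.1 := fun hG => hG.comp continuous_swap
  have c₀ {k : ℝ} : Continuous fun _ : ℝ => k := continuous_const
  have c₁ : Continuous fun y : ℝ => y := continuous_id
  have e₁ : ∫ η in s..x, ∫ θ in η..t, G₁₂ η θ =
      (∫ η in s..x, ∫ θ in η..x, G₁₂ η θ) + ∫ η in s..x, ∫ θ in x..t, G₁₂ η θ := by
    rw [← intervalIntegral.integral_add (hi h₁₂ c₁ c₀ _ _)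
      (hi h₁₂ c₀ c₀ _ _)]
    exact intervalIntegral.integral_congr fun η _ => split (hc h₁₂ η) _ _ _
  have e₂ : ∫ η in x..t, ∫ θ in s..η, G₂₁ η θ =
      (∫ η in x..t, ∫ θ in s..x, G₂₁ η θ) + ∫ η in x..t, ∫ θ in x..η, G₂₁ η θ := by
    rw [← intervalIntegral.integral_add (hi h₂₁ c₀ c₀ _ _)
      (hi h₂₁ c₀ c₁ _ _)]
    exact intervalIntegral.integral_congr fun η _ => split (hc h₂₁ η) _ _ _
  rw [intervalIntegral.integral_add (hi h₁₁ c₀ c₁ _ _) (hi h₁₂ c₁ c₀ _ _),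
    intervalIntegral.integral_add (hi h₂₁ c₀ c₁ _ _) (hi h₂₂ c₁ c₀ _ _),
    intervalIntegral.integral_add ((hi (hs h₁₂) c₀ c₁ _ _).add (hi (hs h₁₁) c₁ c₀ _ _))
      (hi (hs h₂₁) c₀ c₀ _ _),
    intervalIntegral.integral_add (hi (hs h₁₂) c₀ c₁ _ _) (hi (hs h₁₁) c₁ c₀ _ _),
    intervalIntegral.integral_add ((hi (hs h₁₂) c₀ c₀ _ _).add (hi (hs h₂₂) c₀ c₁ _ _))
      (hi (hs h₂₁) c₁ c₀ _ _),
    intervalIntegral.integral_add (hi (hs h₁₂) c₀ c₀ _ _) (hi (hs h₂₂) c₀ c₁ _ _),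
    e₁, e₂, intervalIntegral_triangle_swap h₁₁, intervalIntegral_triangle_swap h₂₁,
    intervalIntegral_triangle_swap' h₁₂, intervalIntegral_triangle_swap' h₂₂,
    intervalIntegral_swap_of_continuous h₁₂, intervalIntegral_swap_of_continuous h₂₁]
  abel

end Fubini

/-! ### Calculus of kernels -/

section Kernels

variable {n p r m : ℕ}

@[fun_prop]
theorem continuous_mInt {X : Type*} [TopologicalSpace X] {F : X → ℝ → Matrix (Fin p) (Fin r) ℝ}
    {l u : X → ℝ} (hF : Continuous fun q : X × ℝ => F q.1 q.2) (hl : Continuous l)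
    (hu : Continuous u) : Continuous fun x => mInt (l x) (u x) (F x) :=
  continuous_matrix fun i j =>
    continuous_intervalIntegral (G := fun x η => F x η i j) (hF.matrix_elem i j) hl hu

@[simp]
theorem mInt_self (s : ℝ) (F : ℝ → Matrix (Fin p) (Fin r) ℝ) : mInt s s F = 0 := by
  ext
  simp [mInt]

theorem mulVec_intervalIntegral (A : Matrix (Fin p) (Fin r) ℝ) {f : ℝ → Fin r → ℝ}
    (hf : Continuous f) (s t : ℝ) :
    A *ᵥ (∫ θ in s..t, f θ) = ∫ θ in s..t, A *ᵥ f θ :=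
  (A.mulVecLin.toContinuousLinearMap.intervalIntegral_comp_comm (hf.intervalIntegrable s t)).symm

theorem mInt_mulVec {F : ℝ → Matrix (Fin p) (Fin r) ℝ} (hF : Continuous F) (v : Fin r → ℝ)
    (s t : ℝ) : mInt s t F *ᵥ v = ∫ η in s..t, F η *ᵥ v := by
  ext i
  have hi : ∀ j, IntervalIntegrable (fun η => F η i j * v j) volume s t := fun j =>
    ((hF.matrix_elem i j).mul continuous_const).intervalIntegrable s t
  have h := ContinuousLinearMap.intervalIntegral_comp_comm
    (ContinuousLinearMap.proj (R := ℝ) (φ := fun _ : Fin p => ℝ) i)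
    ((by fun_prop : Continuous fun η => F η *ᵥ v).intervalIntegrable (μ := volume) s t)
  simp only [ContinuousLinearMap.proj_apply] at h
  rw [← h]
  simp only [mInt, mulVec, dotProduct, Matrix.of_apply]
  rw [intervalIntegral.integral_finsetSum fun j _ => hi j]
  simp only [intervalIntegral.integral_mul_const]

/-- Continuity of a family of 1D-PI kernels on the whole line. -/
structure PI1DK.Cont (N : PI1DK p r) : Prop where
  k0 : Continuous N.k0
  k1 : Continuous fun q : ℝ × ℝ => N.k1 q.1 q.2
  k2 : Continuous fun q : ℝ × ℝ => N.k2 q.1 q.2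

theorem PI1DK.Cont.isCont {N : PI1DK p r} (hN : N.Cont) (s t : ℝ) : N.IsCont s t :=
  ⟨hN.k0.continuousOn, hN.k1.continuousOn, hN.k2.continuousOn⟩

theorem PI1DK.Cont.continuous_PI1D {N : PI1DK p r} (hN : N.Cont) (s t : ℝ) {u : ℝ → Fin r → ℝ}
    (hu : Continuous u) : Continuous (PI1D s t N u) := by
  obtain ⟨h0, h1, h2⟩ := hN
  have c1 := continuous_intervalIntegral (G := fun x θ => N.k1 x θ *ᵥ u θ) (by fun_prop)
    (continuous_const (y := s)) continuous_id
  have c2 := continuous_intervalIntegral (G := fun x θ => N.k2 x θ *ᵥ u θ) (by fun_prop)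
    continuous_id (continuous_const (y := t))
  exact ((h0.matrix_mulVec hu).add c1).add c2

/-- Kernel of the functional `u ↦ ∫ F (P[N] u)` on `[s,t]`. -/
def PI1DK.rowComp (s t : ℝ) (F : ℝ → Matrix (Fin n) (Fin p) ℝ) (N : PI1DK p r) (θ : ℝ) :
    Matrix (Fin n) (Fin r) ℝ :=
  F θ * N.k0 θ + (mInt s θ (fun η => F η * N.k2 η θ) + mInt θ t (fun η => F η * N.k1 η θ))

/-- The 1D-PI operator with kernels `N` applied to the columns of `M`. -/
def PI1DK.colComp (s t : ℝ) (N : PI1DK n p) (M : ℝ → Matrix (Fin p) (Fin r) ℝ) (x : ℝ) :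
    Matrix (Fin n) (Fin r) ℝ :=
  N.k0 x * M x + mInt s x (fun η => N.k1 x η * M η) + mInt x t (fun η => N.k2 x η * M η)

/-- Kernels of the composition of two 1D-PI operators on `[s,t]`. -/
def PI1DK.comp (s t : ℝ) (A : PI1DK n p) (C : PI1DK p r) : PI1DK n r where
  k0 x := A.k0 x * C.k0 x
  k1 x θ := A.k0 x * C.k1 x θ + A.k1 x θ * C.k0 θ +
    (mInt s θ (fun η => A.k1 x η * C.k2 η θ) + mInt θ x (fun η => A.k1 x η * C.k1 η θ) +
      mInt x t (fun η => A.k2 x η * C.k1 η θ))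
  k2 x θ := A.k0 x * C.k2 x θ + A.k2 x θ * C.k0 θ +
    (mInt s x (fun η => A.k1 x η * C.k2 η θ) + mInt x θ (fun η => A.k2 x η * C.k2 η θ) +
      mInt θ t (fun η => A.k2 x η * C.k1 η θ))

theorem PI1DK.Cont.rowComp {N : PI1DK p r} (hN : N.Cont) (s t : ℝ) {X : Type*}
    [TopologicalSpace X] {F : X → ℝ → Matrix (Fin n) (Fin p) ℝ}
    (hF : Continuous fun q : X × ℝ => F q.1 q.2) :
    Continuous fun q : X × ℝ => PI1DK.rowComp s t (F q.1) N q.2 := by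
  obtain ⟨k0, k1, k2⟩ := N
  obtain ⟨h0, h1, h2⟩ := hN
  simp only at h0 h1 h2
  simp only [PI1DK.rowComp]
  fun_prop

theorem PI1DK.Cont.colComp {N : PI1DK n p} (hN : N.Cont) (s t : ℝ) {X : Type*}
    [TopologicalSpace X] {M : X → ℝ → Matrix (Fin p) (Fin r) ℝ}
    (hM : Continuous fun q : X × ℝ => M q.1 q.2) :
    Continuous fun q : X × ℝ => PI1DK.colComp s t N (M q.1) q.2 := by
  obtain ⟨k0, k1, k2⟩ := N
  obtain ⟨h0, h1, h2⟩ := hN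
  simp only at h0 h1 h2
  simp only [PI1DK.colComp]
  fun_prop

theorem PI1DK.Cont.comp {A : PI1DK n p} {C : PI1DK p r} (hA : A.Cont) (hC : C.Cont) (s t : ℝ) :
    (PI1DK.comp s t A C).Cont := by
  obtain ⟨A0, A1, A2⟩ := A
  obtain ⟨C0, C1, C2⟩ := C
  obtain ⟨a0, a1, a2⟩ := hA
  obtain ⟨c0, c1, c2⟩ := hC
  simp only at a0 a1 a2 c0 c1 c2
  refine ⟨?_, ?_, ?_⟩ <;> simp only [PI1DK.comp] <;> fun_prop

theorem integral_mulVec_const {F : ℝ → Matrix (Fin n) (Fin p) ℝ} (hF : Continuous F)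
    {M : ℝ → Matrix (Fin p) (Fin r) ℝ} (hM : Continuous M) (v : Fin r → ℝ) (s t : ℝ) :
    ∫ η in s..t, F η *ᵥ (M η *ᵥ v) = mInt s t (fun η => F η * M η) *ᵥ v := by
  rw [mInt_mulVec (by fun_prop)]
  simp only [mulVec_mulVec]

theorem integral_mulVec_integral {F : ℝ → Matrix (Fin n) (Fin p) ℝ} (hF : Continuous F)
    {M : ℝ → ℝ → Matrix (Fin p) (Fin r) ℝ} (hM : Continuous fun q : ℝ × ℝ => M q.1 q.2)
    {w : ℝ → Fin r → ℝ} (hw : Continuous w) (s t c d : ℝ) :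
    ∫ η in s..t, F η *ᵥ (∫ θ in c..d, M η θ *ᵥ w θ) =
      ∫ θ in c..d, mInt s t (fun η => F η * M η θ) *ᵥ w θ := by
  have h₁ : ∀ η, F η *ᵥ (∫ θ in c..d, M η θ *ᵥ w θ) =
      ∫ θ in c..d, F η *ᵥ (M η θ *ᵥ w θ) := fun η =>
    mulVec_intervalIntegral _ (by fun_prop) _ _
  have h₂ : ∀ θ, mInt s t (fun η => F η * M η θ) *ᵥ w θ =
      ∫ η in s..t, F η *ᵥ (M η θ *ᵥ w θ) := fun θ =>
    (integral_mulVec_const hF (by fun_prop) _ _ _).symm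
  simp only [h₁, h₂]
  exact intervalIntegral_swap_of_continuous (by fun_prop) _ _ _ _

theorem PI1D_add {N : PI1DK p r} (hN : N.Cont) (s t : ℝ) {f g : ℝ → Fin r → ℝ}
    (hf : Continuous f) (hg : Continuous g) (x : ℝ) :
    PI1D s t N (fun y => f y + g y) x = PI1D s t N f x + PI1D s t N g x := by
  obtain ⟨k0, k1, k2⟩ := N
  obtain ⟨h0, h1, h2⟩ := hN
  simp only at h0 h1 h2
  simp only [PI1D, mulVec_add]
  rw [intervalIntegral.integral_add, intervalIntegral.integral_add]
  · abel
  all_goals exact Continuous.intervalIntegrable (by fun_prop) _ _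

theorem PI1D_mulVec_const {N : PI1DK n p} (hN : N.Cont) (s t : ℝ)
    {M : ℝ → Matrix (Fin p) (Fin r) ℝ} (hM : Continuous M) (v : Fin r → ℝ) (x : ℝ) :
    PI1D s t N (fun y => M y *ᵥ v) x = PI1DK.colComp s t N M x *ᵥ v := by
  obtain ⟨k0, k1, k2⟩ := N
  obtain ⟨h0, h1, h2⟩ := hN
  simp only at h0 h1 h2
  simp only [PI1D, PI1DK.colComp, add_mulVec]
  rw [integral_mulVec_const (by fun_prop) hM, integral_mulVec_const (by fun_prop) hM, mulVec_mulVec]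

theorem PI1D_integral {N : PI1DK n p} (hN : N.Cont) (s t c d : ℝ)
    {M : ℝ → ℝ → Matrix (Fin p) (Fin r) ℝ} (hM : Continuous fun q : ℝ × ℝ => M q.1 q.2)
    {w : ℝ → Fin r → ℝ} (hw : Continuous w) (x : ℝ) :
    PI1D s t N (fun y => ∫ ν in c..d, M y ν *ᵥ w ν) x =
      ∫ ν in c..d, PI1DK.colComp s t N (fun y => M y ν) x *ᵥ w ν := by
  obtain ⟨k0, k1, k2⟩ := N
  obtain ⟨h0, h1, h2⟩ := hN
  simp only at h0 h1 h2
  simp only [PI1D, PI1DK.colComp, add_mulVec]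
  rw [integral_mulVec_integral (by fun_prop) hM hw, integral_mulVec_integral (by fun_prop) hM hw,
    mulVec_intervalIntegral _ (by fun_prop), intervalIntegral.integral_add,
    intervalIntegral.integral_add]
  · simp only [mulVec_mulVec]
  all_goals exact Continuous.intervalIntegrable (by fun_prop) _ _

theorem PI1D_comp {A : PI1DK n p} {C : PI1DK p r} (hA : A.Cont) (hC : C.Cont) (s t : ℝ)
    {u : ℝ → Fin r → ℝ} (hu : Continuous u) (x : ℝ) :
    PI1D s t A (PI1D s t C u) x = PI1D s t (PI1DK.comp s t A C) u x := by
  obtain ⟨A0, A1, A2⟩ := A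
  obtain ⟨C0, C1, C2⟩ := C
  obtain ⟨a0, a1, a2⟩ := hA
  obtain ⟨c0, c1, c2⟩ := hC
  simp only at a0 a1 a2 c0 c1 c2
  have hl : ∀ (M : Matrix (Fin n) (Fin p) ℝ) (η : ℝ), M *ᵥ PI1D s t ⟨C0, C1, C2⟩ u η =
      M *ᵥ (C0 η *ᵥ u η) + ((∫ θ in s..η, M *ᵥ (C1 η θ *ᵥ u θ)) +
        ∫ θ in η..t, M *ᵥ (C2 η θ *ᵥ u θ)) := by
    intro M η
    simp only [PI1D, mulVec_add]
    rw [mulVec_intervalIntegral _ (by fun_prop), mulVec_intervalIntegral _ (by fun_prop), add_assoc]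
  have hm : ∀ {F : ℝ → Matrix (Fin n) (Fin p) ℝ} {M : ℝ → ℝ → Matrix (Fin p) (Fin r) ℝ},
      Continuous F → (Continuous fun q : ℝ × ℝ => M q.1 q.2) → ∀ l l' θ,
      mInt l l' (fun η => F η * M η θ) *ᵥ u θ = ∫ η in l..l', F η *ᵥ (M η θ *ᵥ u θ) :=
    fun hF hM l l' θ => (integral_mulVec_const hF (by fun_prop) _ _ _).symm
  have hs := intervalIntegral_PI_swap (G₁₁ := fun η θ => A1 x η *ᵥ (C1 η θ *ᵥ u θ))
    (G₁₂ := fun η θ => A1 x η *ᵥ (C2 η θ *ᵥ u θ)) (G₂₁ := fun η θ => A2 x η *ᵥ (C1 η θ *ᵥ u θ))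
    (G₂₂ := fun η θ => A2 x η *ᵥ (C2 η θ *ᵥ u θ)) (by fun_prop) (by fun_prop) (by fun_prop)
    (by fun_prop) s x t
  rw [PI1D]
  simp only [hl]
  simp only [PI1D, PI1DK.comp, add_mulVec]
  simp only [hm (show Continuous (A1 x) by fun_prop) c1, hm (show Continuous (A1 x) by fun_prop) c2,
    hm (show Continuous (A2 x) by fun_prop) c1, hm (show Continuous (A2 x) by fun_prop) c2,
    ← mulVec_mulVec]
  repeat rw [intervalIntegral.integral_add] at hs
  repeat rw [intervalIntegral.integral_add]
  · linear_combination hs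
  all_goals exact Continuous.intervalIntegrable (by fun_prop) _ _

theorem integral_mulVec_PI1D {N : PI1DK p r} (hN : N.Cont) {F : ℝ → Matrix (Fin n) (Fin p) ℝ}
    (hF : Continuous F) (s t : ℝ) {u : ℝ → Fin r → ℝ} (hu : Continuous u) :
    ∫ η in s..t, F η *ᵥ PI1D s t N u η = ∫ θ in s..t, PI1DK.rowComp s t F N θ *ᵥ u θ := by
  have h := PI1D_comp (A := ⟨fun _ => 0, fun _ => F, fun _ => F⟩)
    ⟨continuous_const, hF.comp continuous_snd, hF.comp continuous_snd⟩ hN s t hu t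
  simpa [PI1D, PI1DK.comp, PI1DK.rowComp] using h

end Kernels

/-! ### Composition of 011-PI operators -/

section Composition

variable {n0 n1 p0 p1 m0 m1 r0 r1 : ℕ}

/-- Continuity of a family of 011-PI kernels on the whole line. -/
structure PI011K.Cont (B : PI011K p0 p1 r0 r1) : Prop where
  b01 : Continuous B.b01
  b02 : Continuous B.b02
  b10 : Continuous B.b10
  b20 : Continuous B.b20
  b12 : Continuous fun q : ℝ × ℝ => B.b12 q.1 q.2
  b21 : Continuous fun q : ℝ × ℝ => B.b21 q.1 q.2
  b11 : B.b11.Cont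
  b22 : B.b22.Cont

theorem PI011K.Cont.isCont {B : PI011K p0 p1 r0 r1} (hB : B.Cont) (a b c d : ℝ) :
    B.IsCont a b c d :=
  ⟨hB.b01.continuousOn, hB.b02.continuousOn, hB.b10.continuousOn, hB.b20.continuousOn,
    hB.b12.continuousOn, hB.b21.continuousOn, hB.b11.isCont a b, hB.b22.isCont c d⟩

/-- Exchange the roles of the two intervals. -/
def PI011K.swap (B : PI011K p0 p1 r0 r1) : PI011K p0 p1 r0 r1 where
  b00 := B.b00
  b01 := B.b02
  b02 := B.b01
  b10 := B.b20
  b20 := B.b10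
  b12 := B.b21
  b21 := B.b12
  b11 := B.b22
  b22 := B.b11

theorem PI011K.Cont.swap {B : PI011K p0 p1 r0 r1} (hB : B.Cont) : B.swap.Cont :=
  ⟨hB.b02, hB.b01, hB.b20, hB.b10, hB.b21, hB.b12, hB.b22, hB.b11⟩

theorem PI011_swap (a b c d : ℝ) (B : PI011K p0 p1 r0 r1) (v : Fin r0 → ℝ)
    (u1 u2 : ℝ → Fin r1 → ℝ) :
    PI011 c d a b B.swap v u2 u1 =
      ((PI011 a b c d B v u1 u2).1, (PI011 a b c d B v u1 u2).2.2,
        (PI011 a b c d B v u1 u2).2.1) := by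
  simp only [PI011, PI011K.swap, Prod.mk.injEq]
  exact ⟨add_right_comm _ _ _, funext fun _ => add_right_comm _ _ _,
    funext fun _ => add_right_comm _ _ _⟩

namespace PI011K

variable (a b c d : ℝ) (B : PI011K n0 n1 p0 p1) (D : PI011K p0 p1 m0 m1)

/-- The kernel `b00` of a composition. -/
def comp00 : Matrix (Fin n0) (Fin m0) ℝ :=
  B.b00 * D.b00 + mInt a b (fun η => B.b01 η * D.b10 η) + mInt c d (fun η => B.b02 η * D.b20 η)

/-- The kernel `b01` of a composition. -/
def comp01 (θ : ℝ) : Matrix (Fin n0) (Fin m1) ℝ :=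
  B.b00 * D.b01 θ + PI1DK.rowComp a b B.b01 D.b11 θ + mInt c d (fun η => B.b02 η * D.b21 η θ)

/-- The kernel `b10` of a composition. -/
def comp10 (x : ℝ) : Matrix (Fin n1) (Fin m0) ℝ :=
  B.b10 x * D.b00 + PI1DK.colComp a b B.b11 D.b10 x + mInt c d (fun η => B.b12 x η * D.b20 η)

/-- The kernel `b12` of a composition. -/
def comp12 (x ν : ℝ) : Matrix (Fin n1) (Fin m1) ℝ :=
  B.b10 x * D.b02 ν + PI1DK.colComp a b B.b11 (fun y => D.b12 y ν) x +
    PI1DK.rowComp c d (B.b12 x) D.b22 ν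

/-- The contribution to the kernel `b11` of a composition that does not come from the composition
of the 1D-PI kernels. -/
def compCross (x θ : ℝ) : Matrix (Fin n1) (Fin m1) ℝ :=
  B.b10 x * D.b01 θ + mInt c d (fun η => B.b12 x η * D.b21 η θ)

/-- The kernels `b11` of a composition. -/
def comp11 : PI1DK n1 m1 where
  k0 := (PI1DK.comp a b B.b11 D.b11).k0
  k1 x θ := (PI1DK.comp a b B.b11 D.b11).k1 x θ + compCross c d B D x θ
  k2 x θ := (PI1DK.comp a b B.b11 D.b11).k2 x θ + compCross c d B D x θ

/-- Kernels of the composition of two 011-PI operators. -/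
def comp : PI011K n0 n1 m0 m1 where
  b00 := comp00 a b c d B D
  b01 := comp01 a b c d B D
  b02 := comp01 c d a b B.swap D.swap
  b10 := comp10 a b c d B D
  b20 := comp10 c d a b B.swap D.swap
  b12 := comp12 a b c d B D
  b21 := comp12 c d a b B.swap D.swap
  b11 := comp11 a b c d B D
  b22 := comp11 c d a b B.swap D.swap

theorem comp_swap : comp c d a b B.swap D.swap = (comp a b c d B D).swap := by
  simp only [comp, PI011K.swap, comp00, add_right_comm]

variable {B D}

theorem Cont.mInt_b21 (hD : D.Cont) {X : Type*} [TopologicalSpace X]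
    {F : X → ℝ → Matrix (Fin n0) (Fin p1) ℝ} (hF : Continuous fun q : X × ℝ => F q.1 q.2) :
    Continuous fun q : X × ℝ => mInt c d (fun η => F q.1 η * D.b21 η q.2) := by
  have h := hD.b21
  generalize D.b21 = K at h
  fun_prop

theorem Cont.comp01 (hB : B.Cont) (hD : D.Cont) : Continuous (comp01 a b c d B D) :=
  ((continuous_const.matrix_mul hD.b01).add
    ((hD.b11.rowComp a b (F := fun _ : ℝ => B.b01) (hB.b01.comp continuous_snd)).comp
      (continuous_id.prodMk continuous_id))).add
    ((hD.mInt_b21 c d (F := fun _ : ℝ => B.b02) (hB.b02.comp continuous_snd)).comp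
      (continuous_id.prodMk continuous_id))

theorem Cont.comp10 (hB : B.Cont) (hD : D.Cont) : Continuous (comp10 a b c d B D) :=
  ((hB.b10.matrix_mul continuous_const).add
    ((hB.b11.colComp a b (M := fun _ : ℝ => D.b10) (hD.b10.comp continuous_snd)).comp
      (continuous_id.prodMk continuous_id))).add
    (continuous_mInt (F := fun x η => B.b12 x η * D.b20 η)
      (hB.b12.matrix_mul (hD.b20.comp continuous_snd)) continuous_const continuous_const)

theorem Cont.comp12 (hB : B.Cont) (hD : D.Cont) :
    Continuous fun q : ℝ × ℝ => comp12 a b c d B D q.1 q.2 :=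
  (((hB.b10.comp continuous_fst).matrix_mul (hD.b02.comp continuous_snd)).add
    ((hB.b11.colComp a b (M := fun ν y => D.b12 y ν) (hD.b12.comp continuous_swap)).comp
      continuous_swap)).add (hD.b22.rowComp c d hB.b12)

theorem Cont.compCross (hB : B.Cont) (hD : D.Cont) :
    Continuous fun q : ℝ × ℝ => compCross c d B D q.1 q.2 :=
  ((hB.b10.comp continuous_fst).matrix_mul (hD.b01.comp continuous_snd)).add
    (hD.mInt_b21 c d hB.b12)

theorem Cont.comp11 (hB : B.Cont) (hD : D.Cont) : (comp11 a b c d B D).Cont :=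
  have h := hB.b11.comp hD.b11 a b
  ⟨h.k0, h.k1.add (hB.compCross c d hD), h.k2.add (hB.compCross c d hD)⟩

theorem Cont.comp (hB : B.Cont) (hD : D.Cont) : (comp a b c d B D).Cont :=
  ⟨hB.comp01 a b c d hD, hB.swap.comp01 c d a b hD.swap, hB.comp10 a b c d hD,
    hB.swap.comp10 c d a b hD.swap, hB.comp12 a b c d hD, hB.swap.comp12 c d a b hD.swap,
    hB.comp11 a b c d hD, hB.swap.comp11 c d a b hD.swap⟩

end PI011K

variable {B : PI011K n0 n1 p0 p1} {D : PI011K p0 p1 m0 m1} {u1 u2 : ℝ → Fin m1 → ℝ}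

theorem integral_add_mulVec {n p : ℕ} {F G : ℝ → Matrix (Fin n) (Fin p) ℝ} (hF : Continuous F)
    (hG : Continuous G) {u : ℝ → Fin p → ℝ} (hu : Continuous u) (s t : ℝ) :
    ∫ θ in s..t, (F θ + G θ) *ᵥ u θ = (∫ θ in s..t, F θ *ᵥ u θ) + ∫ θ in s..t, G θ *ᵥ u θ := by
  simp only [add_mulVec]
  exact intervalIntegral.integral_add ((hF.matrix_mulVec hu).intervalIntegrable _ _)
    ((hG.matrix_mulVec hu).intervalIntegrable _ _)

theorem mulVec_PI011_fst {n : ℕ} (A : Matrix (Fin n) (Fin p0) ℝ) (hD : D.Cont) (a b c d : ℝ)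
    (v : Fin m0 → ℝ) (hu1 : Continuous u1) (hu2 : Continuous u2) :
    A *ᵥ (PI011 a b c d D v u1 u2).1 = (A * D.b00) *ᵥ v + (∫ θ in a..b, (A * D.b01 θ) *ᵥ u1 θ) +
      ∫ ν in c..d, (A * D.b02 ν) *ᵥ u2 ν := by
  simp only [PI011, mulVec_add]
  rw [mulVec_intervalIntegral _ (hD.b01.matrix_mulVec hu1),
    mulVec_intervalIntegral _ (hD.b02.matrix_mulVec hu2)]
  simp only [mulVec_mulVec]

theorem integral_mulVec_PI011 {n : ℕ} {F : ℝ → Matrix (Fin n) (Fin p1) ℝ} (hF : Continuous F)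
    (hD : D.Cont) (a b c d : ℝ) (v : Fin m0 → ℝ) (hu1 : Continuous u1) (hu2 : Continuous u2) :
    ∫ η in a..b, F η *ᵥ (PI011 a b c d D v u1 u2).2.1 η =
      mInt a b (fun η => F η * D.b10 η) *ᵥ v +
        (∫ θ in a..b, PI1DK.rowComp a b F D.b11 θ *ᵥ u1 θ) +
        ∫ ν in c..d, mInt a b (fun η => F η * D.b12 η ν) *ᵥ u2 ν := by
  have h₁ : Continuous fun η => D.b10 η *ᵥ v := hD.b10.matrix_mulVec continuous_const
  have h₂ := hD.b11.continuous_PI1D a b hu1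
  have h₃ : Continuous fun η => ∫ ν in c..d, D.b12 η ν *ᵥ u2 ν :=
    continuous_intervalIntegral (G := fun x ν => D.b12 x ν *ᵥ u2 ν)
      (hD.b12.matrix_mulVec (hu2.comp continuous_snd)) continuous_const continuous_const
  simp only [PI011, mulVec_add]
  rw [intervalIntegral.integral_add, intervalIntegral.integral_add,
    integral_mulVec_const hF hD.b10, integral_mulVec_PI1D hD.b11 hF a b hu1,
    integral_mulVec_integral hF hD.b12 hu2]
  all_goals exact Continuous.intervalIntegrable (by fun_prop) _ _

theorem PI1D_PI011 {n : ℕ} {N : PI1DK n p1} (hN : N.Cont) (hD : D.Cont) (a b c d : ℝ)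
    (v : Fin m0 → ℝ) (hu1 : Continuous u1) (hu2 : Continuous u2) (x : ℝ) :
    PI1D a b N (PI011 a b c d D v u1 u2).2.1 x =
      PI1DK.colComp a b N D.b10 x *ᵥ v + PI1D a b (PI1DK.comp a b N D.b11) u1 x +
        ∫ ν in c..d, PI1DK.colComp a b N (fun y => D.b12 y ν) x *ᵥ u2 ν := by
  have h₁ : Continuous fun η => D.b10 η *ᵥ v := hD.b10.matrix_mulVec continuous_const
  have h₂ := hD.b11.continuous_PI1D a b hu1
  have h₃ : Continuous fun η => ∫ ν in c..d, D.b12 η ν *ᵥ u2 ν :=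
    continuous_intervalIntegral (G := fun x ν => D.b12 x ν *ᵥ u2 ν)
      (hD.b12.matrix_mulVec (hu2.comp continuous_snd)) continuous_const continuous_const
  simp only [PI011]
  rw [PI1D_add hN a b (h₁.fun_add h₂) h₃, PI1D_add hN a b h₁ h₂, PI1D_mulVec_const hN a b hD.b10,
    PI1D_comp hN hD.b11 a b hu1, PI1D_integral hN a b c d hD.b12 hu2]

theorem PI011K.Cont.integral_comp01 (hB : B.Cont) (hD : D.Cont) (a b c d : ℝ)
    {u : ℝ → Fin m1 → ℝ} (hu : Continuous u) :
    ∫ θ in a..b, PI011K.comp01 a b c d B D θ *ᵥ u θ =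
      (∫ θ in a..b, (B.b00 * D.b01 θ) *ᵥ u θ) +
        (∫ θ in a..b, PI1DK.rowComp a b B.b01 D.b11 θ *ᵥ u θ) +
        ∫ θ in a..b, mInt c d (fun η => B.b02 η * D.b21 η θ) *ᵥ u θ := by
  have h₁ : Continuous fun θ => B.b00 * D.b01 θ := continuous_const.matrix_mul hD.b01
  have h₂ : Continuous fun θ => PI1DK.rowComp a b B.b01 D.b11 θ :=
    (hD.b11.rowComp a b (F := fun _ : ℝ => B.b01) (hB.b01.comp continuous_snd)).comp
      (continuous_id.prodMk continuous_id)
  have h₃ : Continuous fun θ => mInt c d (fun η => B.b02 η * D.b21 η θ) :=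
    (hD.mInt_b21 c d (F := fun _ : ℝ => B.b02) (hB.b02.comp continuous_snd)).comp
      (continuous_id.prodMk continuous_id)
  rw [← integral_add_mulVec h₁ h₂ hu, ← integral_add_mulVec (h₁.fun_add h₂) h₃ hu]
  rfl

theorem PI011K.Cont.integral_comp12 (hB : B.Cont) (hD : D.Cont) (a b c d x : ℝ)
    {u : ℝ → Fin m1 → ℝ} (hu : Continuous u) :
    ∫ ν in c..d, PI011K.comp12 a b c d B D x ν *ᵥ u ν =
      (∫ ν in c..d, (B.b10 x * D.b02 ν) *ᵥ u ν) +
        (∫ ν in c..d, PI1DK.colComp a b B.b11 (fun y => D.b12 y ν) x *ᵥ u ν) +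
        ∫ ν in c..d, PI1DK.rowComp c d (B.b12 x) D.b22 ν *ᵥ u ν := by
  have hx : Continuous fun ν : ℝ => (x, ν) := by fun_prop
  have h₁ : Continuous fun ν => B.b10 x * D.b02 ν := continuous_const.matrix_mul hD.b02
  have h₂ : Continuous fun ν => PI1DK.colComp a b B.b11 (fun y => D.b12 y ν) x :=
    (hB.b11.colComp a b (M := fun ν y => D.b12 y ν) (hD.b12.comp continuous_swap)).comp
      (by fun_prop : Continuous fun ν : ℝ => (ν, x))
  have h₃ : Continuous fun ν => PI1DK.rowComp c d (B.b12 x) D.b22 ν :=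
    (hD.b22.rowComp c d hB.b12).comp hx
  rw [← integral_add_mulVec h₁ h₂ hu, ← integral_add_mulVec (h₁.fun_add h₂) h₃ hu]
  rfl

theorem PI1D_comp11 (hB : B.Cont) (hD : D.Cont) (a b c d x : ℝ)
    {u : ℝ → Fin m1 → ℝ} (hu : Continuous u) :
    PI1D a b (PI011K.comp11 a b c d B D) u x =
      PI1D a b (PI1DK.comp a b B.b11 D.b11) u x + (∫ θ in a..b, (B.b10 x * D.b01 θ) *ᵥ u θ) +
        ∫ θ in a..b, mInt c d (fun η => B.b12 x η * D.b21 η θ) *ᵥ u θ := by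
  have hx : Continuous fun θ : ℝ => (x, θ) := by fun_prop
  have h := hB.b11.comp hD.b11 a b
  have hc : Continuous fun θ => PI011K.compCross c d B D x θ := (hB.compCross c d hD).comp hx
  have h₁ : Continuous fun θ => B.b10 x * D.b01 θ := continuous_const.matrix_mul hD.b01
  have h₂ : Continuous fun θ => mInt c d (fun η => B.b12 x η * D.b21 η θ) :=
    (hD.mInt_b21 c d hB.b12).comp hx
  have hk1 : Continuous fun θ => (PI1DK.comp a b B.b11 D.b11).k1 x θ := h.k1.comp hx
  have hk2 : Continuous fun θ => (PI1DK.comp a b B.b11 D.b11).k2 x θ := h.k2.comp hx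
  have hs : (∫ θ in a..x, PI011K.compCross c d B D x θ *ᵥ u θ) +
      (∫ θ in x..b, PI011K.compCross c d B D x θ *ᵥ u θ) =
      (∫ θ in a..b, (B.b10 x * D.b01 θ) *ᵥ u θ) +
        ∫ θ in a..b, mInt c d (fun η => B.b12 x η * D.b21 η θ) *ᵥ u θ := by
    rw [← integral_add_mulVec h₁ h₂ hu]
    exact intervalIntegral.integral_add_adjacent_intervals
      ((hc.matrix_mulVec hu).intervalIntegrable _ _) ((hc.matrix_mulVec hu).intervalIntegrable _ _)
  simp only [PI1D, PI011K.comp11]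
  rw [integral_add_mulVec hk1 hc hu, integral_add_mulVec hk2 hc hu]
  linear_combination hs

theorem PI011_comp_fst (hB : B.Cont) (hD : D.Cont) (a b c d : ℝ)
    (v : Fin m0 → ℝ) (hu1 : Continuous u1) (hu2 : Continuous u2) :
    (PI011 a b c d B (PI011 a b c d D v u1 u2).1 (PI011 a b c d D v u1 u2).2.1
        (PI011 a b c d D v u1 u2).2.2).1 =
      (PI011 a b c d (B.comp a b c d D) v u1 u2).1 := by
  have h₂ := integral_mulVec_PI011 hB.b02 hD.swap c d a b v hu2 hu1
  simp only [PI011_swap] at h₂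
  rw [PI011, mulVec_PI011_fst _ hD a b c d v hu1 hu2,
    integral_mulVec_PI011 hB.b01 hD a b c d v hu1 hu2, h₂]
  simp only [PI011, PI011K.comp]
  rw [hB.integral_comp01 hD a b c d hu1, hB.swap.integral_comp01 hD.swap c d a b hu2]
  simp only [PI011K.swap, PI011K.comp00, add_mulVec]
  abel

theorem PI011_comp_snd (hB : B.Cont) (hD : D.Cont) (a b c d : ℝ)
    (v : Fin m0 → ℝ) (hu1 : Continuous u1) (hu2 : Continuous u2) (x : ℝ) :
    (PI011 a b c d B (PI011 a b c d D v u1 u2).1 (PI011 a b c d D v u1 u2).2.1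
        (PI011 a b c d D v u1 u2).2.2).2.1 x =
      (PI011 a b c d (B.comp a b c d D) v u1 u2).2.1 x := by
  have h₂ := integral_mulVec_PI011 (hB.b12.comp (by fun_prop : Continuous fun ν : ℝ => (x, ν)))
    hD.swap c d a b v hu2 hu1
  simp only [PI011_swap, Function.comp_apply] at h₂
  rw [PI011]
  simp only
  rw [mulVec_PI011_fst _ hD a b c d v hu1 hu2, PI1D_PI011 hB.b11 hD a b c d v hu1 hu2, h₂]
  simp only [PI011, PI011K.comp]
  rw [PI1D_comp11 hB hD a b c d x hu1, hB.integral_comp12 hD a b c d x hu2]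
  simp only [PI011K.swap, PI011K.comp10, add_mulVec, Function.comp_def]
  abel

theorem PI011_comp (hB : B.Cont) (hD : D.Cont) (a b c d : ℝ)
    (v : Fin m0 → ℝ) (hu1 : Continuous u1) (hu2 : Continuous u2) :
    PI011 a b c d B (PI011 a b c d D v u1 u2).1 (PI011 a b c d D v u1 u2).2.1
        (PI011 a b c d D v u1 u2).2.2 =
      PI011 a b c d (B.comp a b c d D) v u1 u2 := by
  refine Prod.ext (PI011_comp_fst hB hD a b c d v hu1 hu2) (Prod.ext
    (funext (PI011_comp_snd hB hD a b c d v hu1 hu2)) (funext fun y => ?_))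
  have h := PI011_comp_snd hB.swap hD.swap c d a b v hu2 hu1 y
  simpa only [PI011K.comp_swap, PI011_swap] using h

end Composition

/-! ### Reduction to kernels that are continuous on the whole line -/

section Clamp

variable {p r p0 p1 r0 r1 : ℕ}

/-- The nearest point of `[s,t]`. -/
def clamp (s t x : ℝ) : ℝ := max s (min x t)

theorem continuous_clamp (s t : ℝ) : Continuous (clamp s t) := by
  unfold clamp
  fun_prop

theorem clamp_mem {s t : ℝ} (h : s ≤ t) (x : ℝ) : clamp s t x ∈ Icc s t :=
  ⟨le_max_left _ _, max_le h (min_le_right _ _)⟩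

theorem clamp_of_mem {s t x : ℝ} (hx : x ∈ Icc s t) : clamp s t x = x := by
  rw [clamp, min_eq_left hx.2, max_eq_right hx.1]

theorem ContinuousOn.comp_clamp {E : Type*} [TopologicalSpace E] {s t : ℝ} (h : s ≤ t)
    {f : ℝ → E} (hf : ContinuousOn f (Icc s t)) : Continuous fun x => f (clamp s t x) :=
  hf.comp_continuous (continuous_clamp s t) (clamp_mem h)

theorem ContinuousOn.comp_clamp₂ {E : Type*} [TopologicalSpace E] {s t s' t' : ℝ} (h : s ≤ t)
    (h' : s' ≤ t') {f : ℝ → ℝ → E}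
    (hf : ContinuousOn (fun q : ℝ × ℝ => f q.1 q.2) (Icc s t ×ˢ Icc s' t')) :
    Continuous fun q : ℝ × ℝ => f (clamp s t q.1) (clamp s' t' q.2) :=
  hf.comp_continuous (((continuous_clamp s t).comp continuous_fst).prodMk
    ((continuous_clamp s' t').comp continuous_snd)) fun _ => ⟨clamp_mem h _, clamp_mem h' _⟩

/-- Extend 1D-PI kernels from `[s,t]` to the whole line. -/
def PI1DK.extend (s t : ℝ) (N : PI1DK p r) : PI1DK p r where
  k0 x := N.k0 (clamp s t x)
  k1 x θ := N.k1 (clamp s t x) (clamp s t θ)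
  k2 x θ := N.k2 (clamp s t x) (clamp s t θ)

theorem PI1DK.IsCont.extend {s t : ℝ} (h : s ≤ t) {N : PI1DK p r} (hN : N.IsCont s t) :
    (N.extend s t).Cont :=
  ⟨hN.1.comp_clamp h, hN.2.1.comp_clamp₂ h h, hN.2.2.comp_clamp₂ h h⟩

/-- Extend 011-PI kernels from `[a,b]` and `[c,d]` to the whole line. -/
def PI011K.extend (a b c d : ℝ) (B : PI011K p0 p1 r0 r1) : PI011K p0 p1 r0 r1 where
  b00 := B.b00
  b01 θ := B.b01 (clamp a b θ)
  b02 ν := B.b02 (clamp c d ν)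
  b10 x := B.b10 (clamp a b x)
  b20 y := B.b20 (clamp c d y)
  b12 x ν := B.b12 (clamp a b x) (clamp c d ν)
  b21 y θ := B.b21 (clamp c d y) (clamp a b θ)
  b11 := B.b11.extend a b
  b22 := B.b22.extend c d

theorem PI011K.IsCont.extend {a b c d : ℝ} (hab : a ≤ b) (hcd : c ≤ d)
    {B : PI011K p0 p1 r0 r1} (hB : B.IsCont a b c d) : (B.extend a b c d).Cont := by
  obtain ⟨h01, h02, h10, h20, h12, h21, h11, h22⟩ := hB
  exact ⟨h01.comp_clamp hab, h02.comp_clamp hcd, h10.comp_clamp hab, h20.comp_clamp hcd,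
    h12.comp_clamp₂ hab hcd, h21.comp_clamp₂ hcd hab, h11.extend hab, h22.extend hcd⟩

theorem integral_mulVec_congr {s t s' t' : ℝ} (hs : s' ∈ Icc s t) (ht : t' ∈ Icc s t)
    {F G : ℝ → Matrix (Fin p) (Fin r) ℝ} {u w : ℝ → Fin r → ℝ} (hF : EqOn F G (Icc s t))
    (hu : EqOn u w (Icc s t)) : ∫ θ in s'..t', F θ *ᵥ u θ = ∫ θ in s'..t', G θ *ᵥ w θ := by
  refine intervalIntegral.integral_congr fun θ hθ => ?_
  have hm : θ ∈ Icc s t := uIcc_subset_Icc hs ht hθ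
  simp only [hF hm, hu hm]

theorem PI1D_extend {s t : ℝ} (N : PI1DK p r) {u w : ℝ → Fin r → ℝ} (hu : EqOn u w (Icc s t)) :
    EqOn (PI1D s t (N.extend s t) u) (PI1D s t N w) (Icc s t) := by
  intro x hx
  have h := hx.1.trans hx.2
  simp only [PI1D, PI1DK.extend, clamp_of_mem hx, hu hx]
  rw [integral_mulVec_congr (left_mem_Icc.2 h) hx (G := N.k1 x) (fun θ hθ => by
      simp only [clamp_of_mem hθ]) hu,
    integral_mulVec_congr hx (right_mem_Icc.2 h) (G := N.k2 x) (fun θ hθ => by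
      simp only [clamp_of_mem hθ]) hu]

theorem PI011_extend {a b c d : ℝ} (hab : a ≤ b) (hcd : c ≤ d) (B : PI011K p0 p1 r0 r1)
    (v : Fin r0 → ℝ) {u1 u2 w1 w2 : ℝ → Fin r1 → ℝ} (h1 : EqOn u1 w1 (Icc a b))
    (h2 : EqOn u2 w2 (Icc c d)) :
    (PI011 a b c d (B.extend a b c d) v u1 u2).1 = (PI011 a b c d B v w1 w2).1 ∧
      EqOn (PI011 a b c d (B.extend a b c d) v u1 u2).2.1 (PI011 a b c d B v w1 w2).2.1
        (Icc a b) ∧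
      EqOn (PI011 a b c d (B.extend a b c d) v u1 u2).2.2 (PI011 a b c d B v w1 w2).2.2
        (Icc c d) := by
  have hl : ∀ {n : ℕ} (F : ℝ → Matrix (Fin n) (Fin r1) ℝ),
      ∫ θ in a..b, F (clamp a b θ) *ᵥ u1 θ = ∫ θ in a..b, F θ *ᵥ w1 θ := fun F =>
    integral_mulVec_congr (left_mem_Icc.2 hab) (right_mem_Icc.2 hab)
      (fun θ hθ => by simp only [clamp_of_mem hθ]) h1
  have hr : ∀ {n : ℕ} (F : ℝ → Matrix (Fin n) (Fin r1) ℝ),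
      ∫ θ in c..d, F (clamp c d θ) *ᵥ u2 θ = ∫ θ in c..d, F θ *ᵥ w2 θ := fun F =>
    integral_mulVec_congr (left_mem_Icc.2 hcd) (right_mem_Icc.2 hcd)
      (fun θ hθ => by simp only [clamp_of_mem hθ]) h2
  refine ⟨?_, fun x hx => ?_, fun y hy => ?_⟩
  · simp only [PI011, PI011K.extend, hl, hr]
  · simp only [PI011, PI011K.extend, clamp_of_mem hx, hr (B.b12 x), PI1D_extend B.b11 h1 hx]
  · simp only [PI011, PI011K.extend, clamp_of_mem hy, hl (B.b21 y), PI1D_extend B.b22 h2 hy]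

theorem PI011_congr {a b c d : ℝ} (hab : a ≤ b) (hcd : c ≤ d) (B : PI011K p0 p1 r0 r1)
    (v : Fin r0 → ℝ) {u1 u2 w1 w2 : ℝ → Fin r1 → ℝ} (h1 : EqOn u1 w1 (Icc a b))
    (h2 : EqOn u2 w2 (Icc c d)) :
    (PI011 a b c d B v u1 u2).1 = (PI011 a b c d B v w1 w2).1 ∧
      EqOn (PI011 a b c d B v u1 u2).2.1 (PI011 a b c d B v w1 w2).2.1 (Icc a b) ∧
      EqOn (PI011 a b c d B v u1 u2).2.2 (PI011 a b c d B v w1 w2).2.2 (Icc c d) := by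
  obtain ⟨e0, e1, e2⟩ := PI011_extend hab hcd B v (eqOn_refl u1 _) (eqOn_refl u2 _)
  obtain ⟨f0, f1, f2⟩ := PI011_extend hab hcd B v h1 h2
  exact ⟨e0.symm.trans f0, e1.symm.trans f1, e2.symm.trans f2⟩

end Clamp

/-- 011-PI operators are closed under composition. -/
theorem composition_of_011_PI_operators {n0 n1 p0 p1 m0 m1 : ℕ} (a b c d : ℝ)
    (hab : a < b) (hcd : c < d)
    (B : PI011K n0 n1 p0 p1) (D : PI011K p0 p1 m0 m1)
    (hB : B.IsCont a b c d) (hD : D.IsCont a b c d) :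
    ∃ R : PI011K n0 n1 m0 m1, R.IsCont a b c d ∧
      ∀ (v : Fin m0 → ℝ) (u1 u2 : ℝ → Fin m1 → ℝ),
        ContinuousOn u1 (Icc a b) → ContinuousOn u2 (Icc c d) →
        (PI011 a b c d B (PI011 a b c d D v u1 u2).1
            (PI011 a b c d D v u1 u2).2.1 (PI011 a b c d D v u1 u2).2.2).1
          = (PI011 a b c d R v u1 u2).1 ∧
        (∀ x ∈ Icc a b,
          (PI011 a b c d B (PI011 a b c d D v u1 u2).1
              (PI011 a b c d D v u1 u2).2.1 (PI011 a b c d D v u1 u2).2.2).2.1 x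
            = (PI011 a b c d R v u1 u2).2.1 x) ∧
        (∀ y ∈ Icc c d,
          (PI011 a b c d B (PI011 a b c d D v u1 u2).1
              (PI011 a b c d D v u1 u2).2.1 (PI011 a b c d D v u1 u2).2.2).2.2 y
            = (PI011 a b c d R v u1 u2).2.2 y) := by
  refine ⟨(B.extend a b c d).comp a b c d (D.extend a b c d),
    ((hB.extend hab.le hcd.le).comp a b c d (hD.extend hab.le hcd.le)).isCont a b c d,
    fun v u1 u2 hu1 hu2 => ?_⟩
  have h1 : EqOn (fun x => u1 (clamp a b x)) u1 (Icc a b) := fun x hx =>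
    congrArg u1 (clamp_of_mem hx)
  have h2 : EqOn (fun y => u2 (clamp c d y)) u2 (Icc c d) := fun y hy =>
    congrArg u2 (clamp_of_mem hy)
  obtain ⟨e0, e1, e2⟩ := PI011_extend hab.le hcd.le D v h1 h2
  have hB' := PI011_extend hab.le hcd.le B (PI011 a b c d D v u1 u2).1 e1 e2
  rw [← e0, PI011_comp (hB.extend hab.le hcd.le) (hD.extend hab.le hcd.le) a b c d v
    (hu1.comp_clamp hab.le) (hu2.comp_clamp hcd.le)] at hB'
  obtain ⟨f0, f1, f2⟩ := hB'
  obtain ⟨g0, g1, g2⟩ := PI011_congr hab.le hcd.le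
    ((B.extend a b c d).comp a b c d (D.extend a b c d)) v h1 h2
  rw [← e0]
  exact ⟨f0.symm.trans g0, f1.symm.trans g1, f2.symm.trans g2⟩
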